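/- Let A < B, let p₁ ≥ 1, let Ψ₀ ≡ 1, and let Ψ₁,…,Ψ_{k−1} : [A,B] → ℝ and C₂₂ : [A,B] → ℝ^{p₁×p₁} (symmetric-matrix valued) be continuous. Suppose that {Ψ₀,…,Ψ_{k−1}} is a Chebyshev system on [A,B] and that for every nonzero vector Q ∈ ℝ^{p₁} the family {Ψ₀,…,Ψ_{k−1}, x ↦ −QᵀC₂₂(x)Q} is a Chebyshev system on [A,B]. Then for any finitely supported probability measure ξ on [A,B] there exists a finitely supported probability measure ξ⁻ on [A,B] with at most ⌊(k+1)/2⌋ support points such that ∫_A^B Ψ_i dξ⁻ = ∫_A^B Ψ_i dξ for all i = 0,…,k−1 and the matrix ∫_A^B C₂₂(x) dξ⁻(x) − ∫_A^B C₂₂(x) dξ(x) is positive semidefinite. -/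

import Mathlib

open MeasureTheory Set Matrix

/-- A family of functions `Ψ₀, …, Ψ_{k-1}` is a Chebyshev system on `[A,B]` if for all
points `A ≤ x₀ < x₁ < ⋯ < x_{k-1} ≤ B` the matrix `(Ψ i (x j))` has positive determinant. -/
def IsChebyshevSystem (A B : ℝ) {k : ℕ} (Ψ : Fin k → ℝ → ℝ) : Prop :=
  ∀ x : Fin k → ℝ, StrictMono x → (∀ j, x j ∈ Set.Icc A B) →
    0 < (Matrix.of fun i j : Fin k => Ψ i (x j)).det

/-- `ξ` is a design on `[A,B]`: a finitely supported probability measure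
`ξ = ∑_{x ∈ s} w_x δ_x` with support points `s ⊆ [A,B]` and positive weights. -/
def IsDesignOn (A B : ℝ) (ξ : Measure ℝ) (s : Finset ℝ) : Prop :=
  IsProbabilityMeasure ξ ∧ ↑s ⊆ Set.Icc A B ∧ (∀ x ∈ s, 0 < ξ {x}) ∧
    ξ = ∑ x ∈ s, ξ {x} • Measure.dirac x

/-- The entrywise integral `∫ C₂₂(x) dξ(x)` of a matrix-valued function. -/
noncomputable def matrixIntegral {p₁ : ℕ} (C : ℝ → Matrix (Fin p₁) (Fin p₁) ℝ)
    (ξ : Measure ℝ) : Matrix (Fin p₁) (Fin p₁) ℝ :=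
  Matrix.of fun a b => ∫ x, C x a b ∂ξ

open Classical in
/-- The index of a design with support `s` on `[A,B]`: the number of support points in
the open interval `(A,B)` plus one half times the number of support points among the
endpoints `{A, B}`. -/
noncomputable def designIndex (A B : ℝ) (s : Finset ℝ) : ℝ :=
  ((s.filter fun x => x ∈ Set.Ioo A B).card : ℝ) +
    ((s.filter fun x => x = A ∨ x = B).card : ℝ) / 2

/-- The convex hull of a compact set in a finite-dimensional space is compact. -/
theorem isCompact_convexHull_of_finiteDimensional {E : Type*} [NormedAddCommGroup E]
    [NormedSpace ℝ E] [FiniteDimensional ℝ E] {S : Set E} (hS : IsCompact S) :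
    IsCompact (convexHull ℝ S) := by
  have key : convexHull ℝ S = ⋃ n ∈ Finset.range (Module.finrank ℝ E + 2),
      (fun p : (Fin n → ℝ) × (Fin n → E) => ∑ i, p.1 i • p.2 i) ''
        (stdSimplex ℝ (Fin n) ×ˢ Set.univ.pi fun _ => S) := by
    apply Set.Subset.antisymm
    · intro x hx
      obtain ⟨ι, _, z, w, hz, hind, hw, hw1, rfl⟩ := eq_pos_convex_span_of_mem_convexHull hx
      have hcard : Fintype.card ι ≤ Module.finrank ℝ E + 1 :=
        hind.card_le_finrank_succ.trans (Nat.succ_le_succ (Submodule.finrank_le _))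
      let e := (Fintype.equivFin ι).symm
      simp only [Set.mem_iUnion]
      refine ⟨Fintype.card ι, Finset.mem_range.2 (by lia), (w ∘ e, z ∘ e),
        ⟨⟨fun i => (hw _).le, ?_⟩, fun i _ => hz ⟨_, rfl⟩⟩, ?_⟩
      · exact (Equiv.sum_comp e w).trans hw1
      · exact Equiv.sum_comp e fun i => w i • z i
    · refine Set.iUnion₂_subset ?_
      rintro n - _ ⟨p, ⟨hp, hpS⟩, rfl⟩
      exact mem_convexHull_of_exists_fintype p.1 p.2 hp.1 hp.2 (fun i => hpS i trivial) rfl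
  rw [key]
  refine Finset.isCompact_biUnion _ fun n _ => IsCompact.image ?_ (by fun_prop)
  exact (isCompact_stdSimplex ℝ _).prod (isCompact_univ_pi fun _ => hS)

/-- `f` is the weight function of a finitely supported probability measure on `S`. -/
structure IsWeightOn (S : Set ℝ) (f : ℝ →₀ ℝ) : Prop where
  nonneg : ∀ x, 0 ≤ f x
  mem_of_pos : ∀ x, 0 < f x → x ∈ S
  total : Finsupp.linearCombination ℝ (fun _ : ℝ => (1 : ℝ)) f = 1

theorem IsWeightOn.mem_of_ne_zero {S : Set ℝ} {f : ℝ →₀ ℝ} (hf : IsWeightOn S f) {x : ℝ}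
    (hx : f x ≠ 0) : x ∈ S :=
  hf.mem_of_pos x ((hf.nonneg x).lt_of_ne' hx)

theorem mem_convexHull_image_iff_exists_weight {E : Type*} [AddCommGroup E] [Module ℝ E]
    (Γ : ℝ → E) (S : Set ℝ) (p : E) :
    p ∈ convexHull ℝ (Γ '' S) ↔
      ∃ f, IsWeightOn S f ∧ Finsupp.linearCombination ℝ Γ f = p := by
  constructor
  · intro hp
    obtain ⟨ι, _, w, z, hw, hw1, hz, rfl⟩ := mem_convexHull_iff_exists_fintype.1 hp
    choose x hxS hx using hz
    refine ⟨∑ i, Finsupp.single (x i) (w i), ⟨fun y => ?_, fun y hy => ?_, ?_⟩, ?_⟩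
    · rw [Finsupp.finsetSum_apply]
      refine Finset.sum_nonneg fun i _ => ?_
      rw [Finsupp.single_apply]
      split_ifs
      · exact hw i
      · exact le_rfl
    · rw [Finsupp.finsetSum_apply] at hy
      obtain ⟨i, -, hi⟩ := Finset.exists_ne_zero_of_sum_ne_zero hy.ne'
      rw [Finsupp.single_apply] at hi
      split_ifs at hi with h
      · exact h ▸ hxS i
      · exact absurd rfl hi
    · simpa using hw1
    · simp [hx]
  · rintro ⟨f, hf, rfl⟩
    rw [Finsupp.linearCombination_apply]
    refine (convex_convexHull ℝ _).sum_mem (fun x _ => hf.nonneg x) ?_ fun x hx =>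
      subset_convexHull ℝ _ ⟨x, hf.mem_of_ne_zero (Finsupp.mem_support_iff.1 hx), rfl⟩
    simpa [Finsupp.linearCombination_apply, Finsupp.sum] using hf.total

/-- Among the weights with prescribed moments, some weight minimises a continuous objective. -/
theorem exists_weight_minimizing {n : ℕ} {S : Set ℝ} (hS : IsCompact S) (Ψ : Fin n → ℝ → ℝ)
    (u : ℝ → ℝ) (hΨ : ∀ i, ContinuousOn (Ψ i) S) (hu : ContinuousOn u S) {f₀ : ℝ →₀ ℝ}
    (hf₀ : IsWeightOn S f₀) :
    ∃ f, IsWeightOn S f ∧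
      (∀ i, Finsupp.linearCombination ℝ (Ψ i) f = Finsupp.linearCombination ℝ (Ψ i) f₀) ∧
      ∀ g, IsWeightOn S g →
        (∀ i, Finsupp.linearCombination ℝ (Ψ i) g = Finsupp.linearCombination ℝ (Ψ i) f₀) →
        Finsupp.linearCombination ℝ u f ≤ Finsupp.linearCombination ℝ u g := by
  let Γ : ℝ → (Fin n → ℝ) × ℝ := fun x => (fun i => Ψ i x, u x)
  have hfst : ∀ f i, (Finsupp.linearCombination ℝ Γ f).1 i =
      Finsupp.linearCombination ℝ (Ψ i) f := fun f i => by
    simp [Γ, Finsupp.linearCombination_apply, Finsupp.sum, Prod.fst_sum]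
  have hsnd : ∀ f, (Finsupp.linearCombination ℝ Γ f).2 = Finsupp.linearCombination ℝ u f :=
    fun f => by simp [Γ, Finsupp.linearCombination_apply, Finsupp.sum, Prod.snd_sum]
  have hΓ : ContinuousOn Γ S := (continuousOn_pi.2 hΨ).prodMk hu
  have hK : IsCompact (convexHull ℝ (Γ '' S) ∩
      {p | p.1 = (Finsupp.linearCombination ℝ Γ f₀).1}) :=
    (isCompact_convexHull_of_finiteDimensional (hS.image_of_continuousOn hΓ)).inter_right
      (isClosed_eq continuous_fst continuous_const)
  obtain ⟨p, ⟨hp, hp1⟩, hmin⟩ := hK.exists_isMinOn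
    ⟨_, (mem_convexHull_image_iff_exists_weight Γ S _).2 ⟨f₀, hf₀, rfl⟩, rfl⟩
    continuous_snd.continuousOn
  obtain ⟨f, hf, rfl⟩ := (mem_convexHull_image_iff_exists_weight Γ S _).1 hp
  refine ⟨f, hf, fun i => ?_, fun g hg hgm => ?_⟩
  · rw [← hfst, ← hfst]
    exact congrFun hp1 i
  · rw [← hsnd, ← hsnd]
    refine hmin ⟨(mem_convexHull_image_iff_exists_weight Γ S _).2 ⟨g, hg, rfl⟩, ?_⟩
    funext i
    rw [hfst, hfst, hgm]

/-- On `k + 1` ordered points there is a signed measure annihilating `Ψ`, with negative integral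
of `u`, and whose weights are nonnegative at every second point starting from the penultimate. -/
theorem IsChebyshevSystem.exists_descent {A B : ℝ} {k : ℕ} {Ψ : Fin k → ℝ → ℝ} {u : ℝ → ℝ}
    (hΨ : IsChebyshevSystem A B Ψ)
    (hu : IsChebyshevSystem (k := k + 1) A B (Fin.snoc Ψ u))
    {z : Fin (k + 1) → ℝ} (hz : StrictMono z) (hzI : ∀ j, z j ∈ Set.Icc A B) :
    ∃ c : Fin (k + 1) → ℝ, (∀ j, Odd (k + j.val) → 0 ≤ c j) ∧
      (∀ i, ∑ j, c j * Ψ i (z j) = 0) ∧ ∑ j, c j * u (z j) < 0 := by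
  have hdet := hu z hz hzI
  set M : Matrix (Fin (k + 1)) (Fin (k + 1)) ℝ :=
    Matrix.of fun i j => (Fin.snoc Ψ u : Fin (k + 1) → ℝ → ℝ) i (z j) with hM
  have hmul := M.mul_adjugate
  have hentry : ∀ i, ∑ j, M i j * M.adjugate j (Fin.last k) =
      (M.det • (1 : Matrix (Fin (k + 1)) (Fin (k + 1)) ℝ)) i (Fin.last k) := fun i => by
    rw [← hmul, Matrix.mul_apply]
  refine ⟨fun j => -M.adjugate j (Fin.last k), fun j hj => ?_, fun i => ?_, ?_⟩
  · change 0 ≤ -M.adjugate j (Fin.last k)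
    rw [Matrix.adjugate_fin_succ_eq_det_submatrix, Fin.val_last, hj.neg_one_pow]
    have hsub : M.submatrix (Fin.last k).succAbove j.succAbove =
        Matrix.of fun i l => Ψ i (z (j.succAbove l)) := by
      ext i l
      simp [hM]
    have := hΨ (z ∘ j.succAbove) (hz.comp (Fin.strictMono_succAbove j)) fun l => hzI _
    rw [hsub]
    simpa using this.le
  · have := hentry i.castSucc
    simp [hM, (Fin.castSucc_lt_last i).ne] at this
    simpa [mul_comm] using this
  · have := hentry (Fin.last k)
    simp only [hM, Matrix.of_apply, Fin.snoc_last, Matrix.smul_apply, Matrix.one_apply_eq,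
      smul_eq_mul, mul_one] at this
    simp only [neg_mul, Finset.sum_neg_distrib, neg_lt_zero]
    calc 0 < M.det := hdet
      _ = _ := by rw [← this]; exact Finset.sum_congr rfl fun j _ => mul_comm _ _

/-- A weight which charges every second of `k + 1` ordered points, starting from the last one,
does not minimise the integral of `u` among weights with the same moments. -/
theorem IsChebyshevSystem.exists_lt_weight {A B : ℝ} {k : ℕ} {Ψ : Fin k → ℝ → ℝ} {u : ℝ → ℝ}
    (hk : 0 < k) (hΨ0 : ∀ x, Ψ ⟨0, hk⟩ x = 1) (hΨ : IsChebyshevSystem A B Ψ)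
    (hu : IsChebyshevSystem (k := k + 1) A B (Fin.snoc Ψ u))
    {z : Fin (k + 1) → ℝ} (hz : StrictMono z) (hzI : ∀ j, z j ∈ Set.Icc A B)
    {f : ℝ →₀ ℝ} (hf : IsWeightOn (Set.Icc A B) f)
    (hfz : ∀ j : Fin (k + 1), Even (k + j.val) → 0 < f (z j)) :
    ∃ g, IsWeightOn (Set.Icc A B) g ∧
      (∀ i, Finsupp.linearCombination ℝ (Ψ i) g = Finsupp.linearCombination ℝ (Ψ i) f) ∧
      Finsupp.linearCombination ℝ u g < Finsupp.linearCombination ℝ u f := by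
  obtain ⟨c, hc, hcΨ, hcu⟩ := hΨ.exists_descent hu hz hzI
  have hev : ∀ᶠ ε in nhdsWithin (0 : ℝ) (Set.Ioi 0), ∀ j, 0 ≤ f (z j) + ε * c j := by
    refine Filter.eventually_all.2 fun j => ?_
    rcases Nat.even_or_odd (k + j.val) with h | h
    · have hlim : Filter.Tendsto (fun ε => f (z j) + ε * c j) (nhds 0)
          (nhds (f (z j) + 0 * c j)) := Continuous.tendsto (by fun_prop) 0
      have hpos : 0 < f (z j) + 0 * c j := by simpa using hfz j h
      exact ((hlim.eventually_const_lt hpos).mono fun _ => le_of_lt).filter_mono nhdsWithin_le_nhds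
    · filter_upwards [self_mem_nhdsWithin] with ε hε
      exact add_nonneg (hf.nonneg _) (mul_nonneg (le_of_lt hε) (hc j h))
  obtain ⟨ε, hε, hε0⟩ := (hev.and self_mem_nhdsWithin).exists
  replace hε0 : 0 < ε := hε0
  let d : ℝ →₀ ℝ := ∑ j, Finsupp.single (z j) (c j)
  have hd : ∀ φ : ℝ → ℝ, Finsupp.linearCombination ℝ φ d = ∑ j, c j * φ (z j) := fun φ => by
    simp [d]
  have hdz : ∀ j, d (z j) = c j := fun j => by
    simp [d, Finsupp.finsetSum_apply, Finsupp.single_apply, hz.injective.eq_iff]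
  have hd0 : ∀ x, (∀ j, z j ≠ x) → d x = 0 := fun x hx => by
    simp [d, Finsupp.finsetSum_apply, hx]
  have hmom : ∀ i, Finsupp.linearCombination ℝ (Ψ i) (f + ε • d) =
      Finsupp.linearCombination ℝ (Ψ i) f := fun i => by
    rw [map_add, map_smul, hd, hcΨ, smul_zero, add_zero]
  refine ⟨f + ε • d, ⟨fun x => ?_, fun x hx => ?_, ?_⟩, hmom, ?_⟩
  · by_cases h : ∃ j, z j = x
    · obtain ⟨j, rfl⟩ := h
      simpa [hdz] using hε j
    · push Not at h
      simpa [hd0 x h] using hf.nonneg x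
  · by_cases h : ∃ j, z j = x
    · obtain ⟨j, rfl⟩ := h
      exact hzI j
    · push Not at h
      exact hf.mem_of_pos x (by simpa [hd0 x h] using hx)
  · have h1 : (fun _ : ℝ => (1 : ℝ)) = Ψ ⟨0, hk⟩ := funext fun x => (hΨ0 x).symm
    rw [h1, hmom, ← h1, hf.total]
  · rw [map_add, map_smul, hd, smul_eq_mul]
    linarith [mul_neg_of_pos_of_neg hε0 hcu]

/-- Given more than `k / 2` points, one can interlace them into `k + 1` ordered points which end
with a given point, every second point being a given one. -/
theorem exists_interlacing {A B : ℝ} {k : ℕ} {S : Finset ℝ} (hS : ↑S ⊆ Set.Icc A B)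
    (hcard : k / 2 < S.card) (hodd : Odd k → A ∉ S) :
    ∃ z : Fin (k + 1) → ℝ, StrictMono z ∧ (∀ j, z j ∈ Set.Icc A B) ∧
      ∀ j : Fin (k + 1), Even (k + j.val) → z j ∈ S := by
  obtain ⟨T, hTS, hT⟩ := Finset.exists_subset_card_eq (Nat.succ_le_of_lt hcard)
  let y := T.orderEmbOfFin hT
  let Y : ℕ → ℝ := fun l => Nat.casesOn l A fun i => y (Fin.ofNat _ i)
  have hYS : ∀ i, Y (i + 1) ∈ S := fun i => hTS (T.orderEmbOfFin_mem hT _)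
  have hYlt : ∀ i < k / 2, Y (i + 1) < Y (i + 2) := fun i hi => by
    refine y.strictMono ?_
    rw [Fin.lt_def, Fin.val_ofNat, Fin.val_ofNat, Nat.mod_eq_of_lt (by lia),
      Nat.mod_eq_of_lt (by lia)]
    lia
  have hY0 : Odd k → Y 0 < Y 1 := fun hk =>
    (hS (hYS 0)).1.lt_of_ne fun h => hodd hk (h ▸ hYS 0)
  obtain ⟨x₀, hx₀⟩ := Finset.card_pos.1 (Nat.zero_lt_of_lt hcard)
  have hYI : ∀ i, Y i ∈ Set.Icc A B := by
    rintro (_ | i)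
    · exact Set.left_mem_Icc.2 ((hS hx₀).1.trans (hS hx₀).2)
    · exact hS (hYS i)
  let Z : ℕ → ℝ := fun l => (Y ((l + 1) / 2) + Y (l / 2 + 1)) / 2
  have hZeven : ∀ i, Z (2 * i) = (Y i + Y (i + 1)) / 2 := fun i => by
    simp only [Z]
    rw [show (2 * i + 1) / 2 = i by lia, show 2 * i / 2 = i by lia]
  have hZodd : ∀ i, Z (2 * i + 1) = Y (i + 1) := fun i => by
    simp only [Z]
    rw [show (2 * i + 1 + 1) / 2 = i + 1 by lia, show (2 * i + 1) / 2 = i by lia, add_self_div_two]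
  refine ⟨fun j => Z (j + (1 - k % 2)), Fin.strictMono_iff_lt_succ.2 fun j => ?_, fun j => ?_,
    fun j hj => ?_⟩
  · have hj := j.isLt
    rw [Fin.val_castSucc, Fin.val_succ, add_right_comm]
    obtain ⟨i, hi | hi⟩ := Nat.even_or_odd' (j.val + (1 - k % 2))
    · have hlt : Y i < Y (i + 1) := by
        rcases i with _ | i
        · exact hY0 (Nat.odd_iff.2 (by lia))
        · exact hYlt i (by lia)
      rw [hi, hZeven, hZodd]
      linarith
    · have hlt := hYlt i (by lia)
      rw [hi, hZodd, show 2 * i + 1 + 1 = 2 * (i + 1) by lia, hZeven]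
      linarith
  · have h1 := hYI ((j + (1 - k % 2) + 1) / 2)
    have h2 := hYI ((j + (1 - k % 2)) / 2 + 1)
    constructor <;> simp only [Z] <;> linarith [h1.1, h2.1, h1.2, h2.2]
  · obtain ⟨i, hi⟩ : ∃ i, j.val + (1 - k % 2) = 2 * i + 1 := by
      obtain ⟨r, hr⟩ := hj
      exact ⟨(j.val + (1 - k % 2)) / 2, by omega⟩
    change Z (j.val + (1 - k % 2)) ∈ S
    rw [hi, hZodd]
    exact hYS i

/-- A signed measure supported on at most `k` points and annihilating a Chebyshev system of
length `k` vanishes. -/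
theorem IsChebyshevSystem.eq_zero_of_card_support_le {A B : ℝ} (hAB : A < B) {k : ℕ}
    {Ψ : Fin k → ℝ → ℝ} (hΨ : IsChebyshevSystem A B Ψ) {h : ℝ →₀ ℝ}
    (hI : ↑h.support ⊆ Set.Icc A B) (hcard : h.support.card ≤ k)
    (hmom : ∀ i, Finsupp.linearCombination ℝ (Ψ i) h = 0) : h = 0 := by
  obtain ⟨T, hsub, hTI, hT⟩ : ∃ T : Finset ℝ, h.support ⊆ T ∧ ↑T ⊆ Set.Icc A B ∧ T.card = k := by
    obtain ⟨R, hR, hRc⟩ :=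
      ((Set.Icc_infinite hAB).sdiff h.support.finite_toSet).exists_subset_card_eq
        (k - h.support.card)
    refine ⟨h.support ∪ R, Finset.subset_union_left, ?_, ?_⟩
    · rw [Finset.coe_union]
      exact Set.union_subset hI (hR.trans Set.sdiff_subset)
    · rw [Finset.card_union_of_disjoint, hRc]
      · lia
      · exact Finset.disjoint_right.2 fun x hx => (hR hx).2
  let z := T.orderEmbOfFin hT
  have hdet := hΨ z z.strictMono fun j => hTI (T.orderEmbOfFin_mem hT j)
  have hz : (fun j => h (z j)) = 0 := by
    refine Matrix.eq_zero_of_mulVec_eq_zero hdet.ne' (funext fun i => ?_)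
    rw [Pi.zero_apply, ← hmom i, Finsupp.linearCombination_apply,
      Finsupp.sum_of_support_subset _ hsub _ (by simp),
      ← Finset.map_orderEmbOfFin_univ T hT, Finset.sum_map]
    change ∑ j, Ψ i (z j) * h (z j) = ∑ j, h (z j) * Ψ i (z j)
    exact Finset.sum_congr rfl fun j _ => mul_comm _ _
  ext x
  by_contra hx
  have hxT : x ∈ T := hsub (Finsupp.mem_support_iff.2 hx)
  obtain ⟨j, rfl⟩ : x ∈ Set.range z := by
    rw [Finset.range_orderEmbOfFin]
    exact hxT
  exact hx (congrFun hz j)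

/-- The support of a weight minimising the integral of `u` among weights with the same moments
has at most `k / 2` points, the left endpoint not being counted if `k` is odd. -/
theorem IsChebyshevSystem.card_support_le_of_minimizing {A B : ℝ} {k : ℕ} {Ψ : Fin k → ℝ → ℝ}
    {u : ℝ → ℝ} (hk : 0 < k) (hΨ0 : ∀ x, Ψ ⟨0, hk⟩ x = 1) (hΨ : IsChebyshevSystem A B Ψ)
    (hu : IsChebyshevSystem (k := k + 1) A B (Fin.snoc Ψ u))
    {f : ℝ →₀ ℝ} (hf : IsWeightOn (Set.Icc A B) f)
    (hmin : ∀ g, IsWeightOn (Set.Icc A B) g →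
      (∀ i, Finsupp.linearCombination ℝ (Ψ i) g = Finsupp.linearCombination ℝ (Ψ i) f) →
        Finsupp.linearCombination ℝ u f ≤ Finsupp.linearCombination ℝ u g)
    {S : Finset ℝ} (hS : S ⊆ f.support) (hodd : Odd k → A ∉ S) : S.card ≤ k / 2 := by
  by_contra! hcard
  have hne : ∀ x ∈ S, f x ≠ 0 := fun x hx => Finsupp.mem_support_iff.1 (hS hx)
  obtain ⟨z, hz, hzI, hzS⟩ := exists_interlacing
    (fun x hx => hf.mem_of_ne_zero (hne x hx)) hcard hodd
  obtain ⟨g, hg, hgm, hlt⟩ := hΨ.exists_lt_weight hk hΨ0 hu hz hzI hf fun j hj =>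
    (hf.nonneg _).lt_of_ne' (hne _ (hzS j hj))
  exact (hmin g hg hgm).not_gt hlt

/-- A weight function has a lower representation: one with the same moments and few support
points which minimises the integral of every function extending the Chebyshev system. -/
theorem IsChebyshevSystem.exists_lower_weight {A B : ℝ} (hAB : A < B) {k : ℕ}
    {Ψ : Fin k → ℝ → ℝ} (hk : 0 < k) (hΨ0 : ∀ x, Ψ ⟨0, hk⟩ x = 1)
    (hcont : ∀ i, ContinuousOn (Ψ i) (Set.Icc A B)) (hΨ : IsChebyshevSystem A B Ψ)
    {U : Set (ℝ → ℝ)} (hU : U.Nonempty) (hUcont : ∀ u ∈ U, ContinuousOn u (Set.Icc A B))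
    (hUΨ : ∀ u ∈ U, IsChebyshevSystem (k := k + 1) A B (Fin.snoc Ψ u))
    {f₀ : ℝ →₀ ℝ} (hf₀ : IsWeightOn (Set.Icc A B) f₀) :
    ∃ f, IsWeightOn (Set.Icc A B) f ∧ f.support.card ≤ (k + 1) / 2 ∧
      (∀ i, Finsupp.linearCombination ℝ (Ψ i) f = Finsupp.linearCombination ℝ (Ψ i) f₀) ∧
      ∀ u ∈ U, Finsupp.linearCombination ℝ u f ≤ Finsupp.linearCombination ℝ u f₀ := by
  classical
  have hex : ∀ u ∈ U, ∃ f, IsWeightOn (Set.Icc A B) f ∧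
      (∀ i, Finsupp.linearCombination ℝ (Ψ i) f = Finsupp.linearCombination ℝ (Ψ i) f₀) ∧
      Finsupp.linearCombination ℝ u f ≤ Finsupp.linearCombination ℝ u f₀ ∧
      ∀ S ⊆ f.support, (Odd k → A ∉ S) → S.card ≤ k / 2 := fun u hu => by
    obtain ⟨f, hf, hfm, hmin⟩ := exists_weight_minimizing isCompact_Icc Ψ u hcont (hUcont u hu) hf₀
    refine ⟨f, hf, hfm, hmin f₀ hf₀ fun _ => rfl, fun S hS hodd => ?_⟩
    exact hΨ.card_support_le_of_minimizing hk hΨ0 (hUΨ u hu) hf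
      (fun g hg hgm => hmin g hg fun i => (hgm i).trans (hfm i)) hS hodd
  obtain ⟨u₀, hu₀⟩ := hU
  obtain ⟨f, hf, hfm, -, hfS⟩ := hex u₀ hu₀
  have hcard_erase : ∀ T : Finset ℝ, T.card ≤ (T.erase A).card + 1 := fun T => by
    have := Finset.pred_card_le_card_erase (s := T) (a := A)
    lia
  refine ⟨f, hf, ?_, hfm, fun u hu => ?_⟩
  · rcases Nat.even_or_odd k with he | ho
    · have := hfS _ subset_rfl fun h => absurd he (Nat.not_even_iff_odd.2 h)
      lia
    · have h1 := hfS _ (f.support.erase_subset A) fun _ => Finset.notMem_erase _ _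
      have h2 := hcard_erase f.support
      obtain ⟨r, hr⟩ := ho
      lia
  · obtain ⟨g, hg, hgm, hgu, hgS⟩ := hex u hu
    have hsupp : (f - g).support ⊆ f.support ∪ g.support := Finsupp.support_sub
    suffices h : f - g = 0 by rwa [sub_eq_zero.1 h]
    refine hΨ.eq_zero_of_card_support_le hAB (fun x hx => ?_) ?_ fun i => ?_
    · rcases Finset.mem_union.1 (hsupp hx) with h | h
      · exact hf.mem_of_ne_zero (Finsupp.mem_support_iff.1 h)
      · exact hg.mem_of_ne_zero (Finsupp.mem_support_iff.1 h)
    · refine (Finset.card_le_card hsupp).trans ?_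
      rcases Nat.even_or_odd k with he | ho
      · have h1 := hfS _ subset_rfl fun h => absurd he (Nat.not_even_iff_odd.2 h)
        have h2 := hgS _ subset_rfl fun h => absurd he (Nat.not_even_iff_odd.2 h)
        have h3 := Finset.card_union_le f.support g.support
        lia
      · have h1 := hfS _ (f.support.erase_subset A) fun _ => Finset.notMem_erase _ _
        have h2 := hgS _ (g.support.erase_subset A) fun _ => Finset.notMem_erase _ _
        have h3 := hcard_erase (f.support ∪ g.support)
        have h4 := Finset.card_union_le (f.support.erase A) (g.support.erase A)
        rw [← Finset.erase_union_distrib] at h4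
        obtain ⟨r, hr⟩ := ho
        lia
    · rw [map_sub, hfm, hgm, sub_self]

/-- The finitely supported measure with a given weight function. -/
noncomputable def weightMeasure (f : ℝ →₀ ℝ) : Measure ℝ :=
  ∑ x ∈ f.support, ENNReal.ofReal (f x) • Measure.dirac x

theorem integral_sum_smul_dirac (s : Finset ℝ) (c : ℝ → ENNReal) (hc : ∀ x ∈ s, c x ≠ ⊤)
    (φ : ℝ → ℝ) :
    ∫ x, φ x ∂(∑ x ∈ s, c x • Measure.dirac x) = ∑ x ∈ s, (c x).toReal * φ x := by
  rw [integral_finsetSum_measure fun x hx =>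
    (integrable_dirac (enorm_lt_top)).smul_measure (hc x hx)]
  simp [integral_smul_measure]

theorem integral_weightMeasure {S : Set ℝ} {f : ℝ →₀ ℝ} (hf : IsWeightOn S f) (φ : ℝ → ℝ) :
    ∫ x, φ x ∂(weightMeasure f) = Finsupp.linearCombination ℝ φ f := by
  rw [weightMeasure, integral_sum_smul_dirac _ _ fun _ _ => ENNReal.ofReal_ne_top]
  refine Finset.sum_congr rfl fun x _ => ?_
  change (ENNReal.ofReal (f x)).toReal * φ x = f x * φ x
  rw [ENNReal.toReal_ofReal (hf.nonneg x)]

theorem weightMeasure_singleton (f : ℝ →₀ ℝ) (x : ℝ) :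
    weightMeasure f {x} = ENNReal.ofReal (f x) := by
  simp only [weightMeasure, Measure.coe_finsetSum, Finset.sum_apply, Measure.smul_apply,
    Measure.dirac_apply, smul_eq_mul]
  rw [Finset.sum_eq_single x]
  · simp
  · intro y _ hy
    simp [hy]
  · intro hx
    simp [Finsupp.notMem_support_iff.1 hx]

theorem isDesignOn_weightMeasure {A B : ℝ} {f : ℝ →₀ ℝ} (hf : IsWeightOn (Set.Icc A B) f) :
    IsDesignOn A B (weightMeasure f) f.support := by
  refine ⟨⟨?_⟩, fun x hx => hf.mem_of_ne_zero (Finsupp.mem_support_iff.1 hx), fun x hx => ?_, ?_⟩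
  · have h1 := hf.total
    simp only [Finsupp.linearCombination_apply, Finsupp.sum, smul_eq_mul, mul_one] at h1
    simp [weightMeasure, ← ENNReal.ofReal_sum_of_nonneg fun x _ => hf.nonneg x, h1]
  · rw [weightMeasure_singleton, ENNReal.ofReal_pos]
    exact (hf.nonneg x).lt_of_ne' (Finsupp.mem_support_iff.1 hx)
  · simp only [weightMeasure_singleton]
    rfl

/-- Integration against a design is integration against a weight function. -/
theorem IsDesignOn.exists_weight {A B : ℝ} {ξ : Measure ℝ} {s : Finset ℝ}
    (hξ : IsDesignOn A B ξ s) : ∃ f, IsWeightOn (Set.Icc A B) f ∧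
      ∀ φ : ℝ → ℝ, ∫ x, φ x ∂ξ = Finsupp.linearCombination ℝ φ f := by
  classical
  obtain ⟨hprob, hs, -, hsum⟩ := hξ
  let f : ℝ →₀ ℝ := Finsupp.indicator s fun x _ => (ξ {x}).toReal
  have hfs : f.support ⊆ s := Finsupp.support_indicator_subset s _
  have hint : ∀ φ : ℝ → ℝ, ∫ x, φ x ∂ξ = Finsupp.linearCombination ℝ φ f := fun φ => by
    conv_lhs => rw [hsum]
    rw [integral_sum_smul_dirac _ _ fun x _ => measure_ne_top ξ {x},
      Finsupp.linearCombination_apply,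
      Finsupp.sum_of_support_subset _ hfs _ (by simp)]
    exact Finset.sum_congr rfl fun x hx => by rw [Finsupp.indicator_of_mem hx, smul_eq_mul]
  refine ⟨f, ⟨fun x => ?_, fun x hx => ?_, ?_⟩, hint⟩
  · by_cases h : x ∈ s
    · rw [show f x = (ξ {x}).toReal from Finsupp.indicator_of_mem h _]
      exact ENNReal.toReal_nonneg
    · rw [show f x = 0 from Finsupp.indicator_of_notMem h _]
  · exact hs (hfs ((Finsupp.mem_support_iff (f := f)).2 hx.ne'))
  · simp [← hint]

/-- The quadratic form of the integral of a matrix-valued function against a weight measure. -/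
theorem dotProduct_matrixIntegral_mulVec {p₁ : ℕ} (C : ℝ → Matrix (Fin p₁) (Fin p₁) ℝ)
    {ξ : Measure ℝ} {f : ℝ →₀ ℝ}
    (hf : ∀ φ : ℝ → ℝ, ∫ x, φ x ∂ξ = Finsupp.linearCombination ℝ φ f) (Q : Fin p₁ → ℝ) :
    Q ⬝ᵥ (matrixIntegral C ξ *ᵥ Q) =
      -Finsupp.linearCombination ℝ (fun x => -(Q ⬝ᵥ ((C x) *ᵥ Q))) f := by
  simp only [matrixIntegral, hf, Finsupp.linearCombination_apply, Finsupp.sum, dotProduct,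
    Matrix.mulVec, Matrix.of_apply, smul_eq_mul, mul_neg, Finset.sum_neg_distrib, neg_neg,
    Finset.mul_sum, Finset.sum_mul]
  refine (Finset.sum_congr rfl fun _ _ => Finset.sum_comm).trans (Finset.sum_comm.trans ?_)
  refine Finset.sum_congr rfl fun x _ => Finset.sum_congr rfl fun a _ =>
    Finset.sum_congr rfl fun b _ => ?_
  ring

/-- Yang–Stufken complete class theorem, part (2): if `{Ψ₀,…,Ψ_{k-1}}` (with `Ψ₀ ≡ 1`)
and all extensions by `x ↦ -QᵀC₂₂(x)Q` are Chebyshev systems, then every design `ξ` is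
dominated by a design `ξ⁻` with at most `⌊(k+1)/2⌋` support points having the same
`Ψ`-moments and `∫ C₂₂ dξ⁻ - ∫ C₂₂ dξ` positive semidefinite. -/
theorem complete_class_lower
    {k p₁ : ℕ} (hk : 0 < k) (hp : 1 ≤ p₁) (A B : ℝ) (hAB : A < B)
    (Ψ : Fin k → ℝ → ℝ) (C : ℝ → Matrix (Fin p₁) (Fin p₁) ℝ)
    (hΨ0 : ∀ x : ℝ, Ψ ⟨0, hk⟩ x = 1)
    (hcontΨ : ∀ i, ContinuousOn (Ψ i) (Set.Icc A B))
    (hcontC : ∀ a b, ContinuousOn (fun x => C x a b) (Set.Icc A B))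
    (hsymm : ∀ x ∈ Set.Icc A B, (C x).IsSymm)
    (hCheb : IsChebyshevSystem A B Ψ)
    (hChebQ : ∀ Q : Fin p₁ → ℝ, Q ≠ 0 →
      IsChebyshevSystem A B (Fin.snoc Ψ fun x => -(Q ⬝ᵥ ((C x) *ᵥ Q))))
    (ξ : Measure ℝ) (s : Finset ℝ) (hξ : IsDesignOn A B ξ s) :
    ∃ (ξm : Measure ℝ) (sm : Finset ℝ), IsDesignOn A B ξm sm ∧
      sm.card ≤ (k + 1) / 2 ∧
      (∀ i, ∫ x, Ψ i x ∂ξm = ∫ x, Ψ i x ∂ξ) ∧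
      (matrixIntegral C ξm - matrixIntegral C ξ).PosSemidef := by
  obtain ⟨f₀, hf₀, hint₀⟩ := hξ.exists_weight
  obtain ⟨f, hf, hcard, hmom, hmin⟩ := hCheb.exists_lower_weight hAB hk hΨ0 hcontΨ
    (U := (fun (Q : Fin p₁ → ℝ) x => -(Q ⬝ᵥ ((C x) *ᵥ Q))) '' {Q | Q ≠ 0})
    ⟨_, fun _ => 1, fun h => one_ne_zero (congrFun h ⟨0, hp⟩), rfl⟩
    (by
      rintro _ ⟨Q, -, rfl⟩
      simp only [dotProduct, Matrix.mulVec]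
      fun_prop)
    (by
      rintro _ ⟨Q, hQ, rfl⟩
      exact hChebQ Q hQ) hf₀
  have hint := integral_weightMeasure hf
  have hsymmInt : ∀ (g : ℝ →₀ ℝ) (η : Measure ℝ), IsWeightOn (Set.Icc A B) g →
      (∀ φ : ℝ → ℝ, ∫ x, φ x ∂η = Finsupp.linearCombination ℝ φ g) →
      ∀ a b, matrixIntegral C η a b = matrixIntegral C η b a := fun g η hg hη a b => by
    simp only [matrixIntegral, Matrix.of_apply, hη, Finsupp.linearCombination_apply]
    refine Finset.sum_congr rfl fun x hx => ?_
    change g x * C x a b = g x * C x b a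
    rw [(hsymm x (hg.mem_of_ne_zero (Finsupp.mem_support_iff.1 hx))).apply]
  refine ⟨weightMeasure f, f.support, isDesignOn_weightMeasure hf, hcard, fun i => ?_,
    Matrix.PosSemidef.of_dotProduct_mulVec_nonneg ?_ fun Q => ?_⟩
  · rw [hint, hint₀, hmom]
  · refine Matrix.IsHermitian.ext fun a b => ?_
    simp [hsymmInt _ _ hf hint a b, hsymmInt _ _ hf₀ hint₀ a b]
  · rcases eq_or_ne Q 0 with rfl | hQ
    · simp
    · have := hmin _ ⟨Q, hQ, rfl⟩
      rw [star_trivial, Matrix.sub_mulVec, dotProduct_sub,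
        dotProduct_matrixIntegral_mulVec C hint, dotProduct_matrixIntegral_mulVec C hint₀]
      linarith
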